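/- Let n ≥ 4 and let a ∈ ZMod n be a vertex of a convex n-gon. The 'boundary net' at a, namely the set {{a+t, a+t+2} : 0 ≤ t ≤ n−3} of n−2 consecutive ear-covers, is a blocking set: it has nonempty intersection with every triangulation of the n-gon. -/

import Mathlib

namespace ConvexBlockers

/-- Cyclic distance between two vertices of the convex `n`-gon (vertices = `ZMod n`). -/
def cyclicDist {n : ℕ} (i j : ZMod n) : ℕ := min (i - j).val (j - i).val

/-- A diagonal: an unordered pair of vertices at cyclic distance at least 2. -/
def IsDiagonal {n : ℕ} (e : Sym2 (ZMod n)) : Prop :=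
  ∃ i j : ZMod n, e = s(i, j) ∧ 2 ≤ cyclicDist i j

/-- An ear-cover: a diagonal of cyclic distance exactly 2. -/
def IsEarCover {n : ℕ} (e : Sym2 (ZMod n)) : Prop :=
  ∃ i j : ZMod n, e = s(i, j) ∧ cyclicDist i j = 2

/-- `Btw a x b` : `x` lies strictly inside the clockwise arc from `a` to `b`. -/
def Btw {n : ℕ} (a x b : ZMod n) : Prop :=
  0 < (x - a).val ∧ (x - a).val < (b - a).val

/-- Two diagonals cross iff their endpoint pairs strictly interleave in the cyclic order. -/
def Crosses {n : ℕ} (e f : Sym2 (ZMod n)) : Prop :=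
  ∃ a b c d : ZMod n, e = s(a, b) ∧ f = s(c, d) ∧ Btw a c b ∧ Btw b d a

/-- A triangulation: a maximal (w.r.t. inclusion) set of pairwise non-crossing diagonals. -/
def IsTriangulation {n : ℕ} (T : Set (Sym2 (ZMod n))) : Prop :=
  (∀ e ∈ T, IsDiagonal e) ∧
  (∀ e ∈ T, ∀ f ∈ T, ¬ Crosses e f) ∧
  (∀ T' : Set (Sym2 (ZMod n)), (∀ e ∈ T', IsDiagonal e) →
    (∀ e ∈ T', ∀ f ∈ T', ¬ Crosses e f) → T ⊆ T' → T' = T)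

/-- A blocking set: a set of diagonals meeting every triangulation. -/
def IsBlockingSet {n : ℕ} (B : Set (Sym2 (ZMod n))) : Prop :=
  (∀ e ∈ B, IsDiagonal e) ∧
  ∀ T : Set (Sym2 (ZMod n)), IsTriangulation T → (B ∩ T).Nonempty

/-- A blocker: a blocking set of minimum possible cardinality. -/
def IsBlocker {n : ℕ} (B : Set (Sym2 (ZMod n))) : Prop :=
  IsBlockingSet B ∧
  ∀ B' : Set (Sym2 (ZMod n)), IsBlockingSet B' → B.ncard ≤ B'.ncard

lemma val_add_natCast_sub {n : ℕ} [NeZero n] (a : ZMod n) {p q : ℕ} (hp : p < n) (hq : q < n) :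
    ((a + (p : ZMod n)) - (a + (q : ZMod n))).val = if q ≤ p then p - q else n + p - q := by
  have key : ∀ m : ℕ, m < n → (m : ZMod n) = a + p - (a + q) →
      (a + (p : ZMod n) - (a + q)).val = m := by
    intro m hm h
    rw [← h, ZMod.val_cast_of_lt hm]
  split_ifs with h
  · refine key _ (by omega) ?_
    rw [Nat.cast_sub h]
    ring
  · refine key _ (by omega) ?_
    rw [Nat.cast_sub (by omega), Nat.cast_add, ZMod.natCast_self]
    ring

lemma exists_eq_add_natCast {n : ℕ} [NeZero n] (a x : ZMod n) :
    ∃ p : ℕ, p < n ∧ x = a + (p : ZMod n) :=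
  ⟨(x - a).val, ZMod.val_lt _, by rw [ZMod.natCast_zmod_val]; ring⟩

lemma btw_add_natCast_iff {n : ℕ} [NeZero n] (a : ZMod n) {p q r : ℕ}
    (hp : p < n) (hq : q < n) (hr : r < n) :
    Btw (a + (p : ZMod n)) (a + (q : ZMod n)) (a + (r : ZMod n)) ↔
      (p < q ∧ q < r) ∨ (q < r ∧ r < p) ∨ (r < p ∧ p < q) := by
  unfold Btw
  rw [val_add_natCast_sub a hq hp, val_add_natCast_sub a hr hp]
  split_ifs <;> omega

lemma two_le_cyclicDist_iff {n : ℕ} [NeZero n] (a : ZMod n) {p q : ℕ} (hpq : p < q) (hq : q < n) :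
    2 ≤ cyclicDist (a + (p : ZMod n)) (a + (q : ZMod n)) ↔ p + 2 ≤ q ∧ q + 2 ≤ n + p := by
  unfold cyclicDist
  rw [val_add_natCast_sub a (hpq.trans hq) hq, val_add_natCast_sub a hq (hpq.trans hq)]
  split_ifs <;> omega

lemma Crosses.symm {n : ℕ} [NeZero n] {e f : Sym2 (ZMod n)} (h : Crosses e f) : Crosses f e := by
  obtain ⟨a, b, c, d, rfl, rfl, h₁, h₂⟩ := h
  refine ⟨c, d, b, a, rfl, Sym2.eq_swap, ?_⟩
  obtain ⟨p, hp, rfl⟩ := exists_eq_add_natCast 0 a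
  obtain ⟨q, hq, rfl⟩ := exists_eq_add_natCast 0 b
  obtain ⟨r, hr, rfl⟩ := exists_eq_add_natCast 0 c
  obtain ⟨s, hs, rfl⟩ := exists_eq_add_natCast 0 d
  rw [btw_add_natCast_iff 0 hp hr hq] at h₁
  rw [btw_add_natCast_iff 0 hq hs hp] at h₂
  rw [btw_add_natCast_iff 0 hr hq hs, btw_add_natCast_iff 0 hs hp hr]
  omega

lemma not_crosses_self {n : ℕ} (e : Sym2 (ZMod n)) : ¬ Crosses e e := by
  rintro ⟨a, b, c, d, rfl, h, h₁, -⟩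
  rcases Sym2.eq_iff.1 h with ⟨rfl, rfl⟩ | ⟨rfl, rfl⟩
  · simp [Btw] at h₁
  · exact lt_irrefl _ h₁.2

/-- Crossing in linear coordinates relative to a base vertex `a`. -/
lemma crosses_iff {n : ℕ} [NeZero n] (a : ZMod n) {i j : ℕ} (hij : i < j) (hj : j < n)
    (f : Sym2 (ZMod n)) :
    Crosses s(a + (i : ZMod n), a + (j : ZMod n)) f ↔
      ∃ k l : ℕ, f = s(a + (k : ZMod n), a + (l : ZMod n)) ∧ i < k ∧ k < j ∧ l < n ∧
        (l < i ∨ j < l) := by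
  have hi := hij.trans hj
  constructor
  · rintro ⟨x, y, c, d, h, rfl, h₁, h₂⟩
    obtain ⟨k, hk, rfl⟩ := exists_eq_add_natCast a c
    obtain ⟨l, hl, rfl⟩ := exists_eq_add_natCast a d
    rcases Sym2.eq_iff.1 h with ⟨rfl, rfl⟩ | ⟨rfl, rfl⟩
    · rw [btw_add_natCast_iff a hi hk hj] at h₁
      rw [btw_add_natCast_iff a hj hl hi] at h₂
      exact ⟨k, l, rfl, by omega⟩
    · rw [btw_add_natCast_iff a hj hk hi] at h₁
      rw [btw_add_natCast_iff a hi hl hj] at h₂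
      exact ⟨l, k, Sym2.eq_swap, by omega⟩
  · rintro ⟨k, l, rfl, hik, hkj, hl, h⟩
    refine ⟨_, _, _, _, rfl, rfl, ?_⟩
    rw [btw_add_natCast_iff a hi (hkj.trans hj) hj, btw_add_natCast_iff a hj hl hi]
    omega

/-- A diagonal outside a triangulation is crossed by one of its members. -/
lemma IsTriangulation.exists_crosses {n : ℕ} [NeZero n] {T : Set (Sym2 (ZMod n))}
    (hT : IsTriangulation T) {e : Sym2 (ZMod n)} (he : IsDiagonal e) (heT : e ∉ T) :
    ∃ f ∈ T, Crosses e f := by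
  by_contra! h
  refine heT ?_
  rw [← hT.2.2 (insert e T) ?_ ?_ (Set.subset_insert e T)]
  · exact Set.mem_insert e T
  · rintro f (rfl | hf)
    exacts [he, hT.1 f hf]
  · rintro f (rfl | hf) g (rfl | hg)
    exacts [not_crosses_self _, h g hg, fun hc => h f hf hc.symm, hT.2.1 f hf g hg]

/-- A chord `{a + i, a + j}` which is the side `{a, a + (n - 1)}` or lies in a triangulation `T`
has some ear-cover of `T` on the linear interval `[i, j]`. -/
lemma IsTriangulation.exists_earCover {n : ℕ} [NeZero n] {T : Set (Sym2 (ZMod n))}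
    (hT : IsTriangulation T) (hn : 4 ≤ n) (a : ZMod n) (m : ℕ) :
    ∀ i j : ℕ, i + m = j → 2 ≤ m → j < n →
      (s(a + (i : ZMod n), a + (j : ZMod n)) ∈ T ∨ m = n - 1) →
      ∃ t : ℕ, t + 2 < n ∧ s(a + (t : ZMod n), a + ((t + 2 : ℕ) : ZMod n)) ∈ T := by
  induction m using Nat.strong_induction_on with
  | _ m ih =>
    rintro i j rfl hm hj h
    by_cases heT : s(a + (i : ZMod n), a + ((i + 2 : ℕ) : ZMod n)) ∈ T
    · exact ⟨i, by omega, heT⟩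
    have hm3 : 2 < m := by
      refine lt_of_le_of_ne hm ?_
      rintro rfl
      rcases h with h | h
      · exact heT h
      · omega
    have hd : IsDiagonal s(a + (i : ZMod n), a + ((i + 2 : ℕ) : ZMod n)) :=
      ⟨_, _, rfl, (two_le_cyclicDist_iff a (by omega) (by omega)).2 (by omega)⟩
    obtain ⟨f, hf, hc⟩ := hT.exists_crosses hd heT
    obtain ⟨k, l, rfl, hik, hki, hl, hlo⟩ := (crosses_iff a (by omega) (by omega) f).1 hc
    obtain rfl : k = i + 1 := by omega
    have hin : i ≤ l ∧ l ≤ i + m := by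
      rcases h with h | h
      · by_contra hout
        exact hT.2.1 _ h _ hf ((crosses_iff a (by omega) hj _).2
          ⟨i + 1, l, rfl, by omega, by omega, hl, by omega⟩)
      · omega
    exact ih (l - (i + 1)) (by omega) (i + 1) l (by omega) (by omega) hl (Or.inl hf)

/-- The 'boundary net' of n-2 consecutive ear-covers is a blocking set. -/
theorem boundary_net_is_blocking {n : ℕ} (hn : 4 ≤ n) (a : ZMod n) :
    IsBlockingSet
      {e : Sym2 (ZMod n) | ∃ t : ℕ, t ≤ n - 3 ∧ e = s(a + (t : ZMod n), a + (t : ZMod n) + 2)} := by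
  have : NeZero n := ⟨by omega⟩
  have hcast (t : ℕ) : a + (t : ZMod n) + 2 = a + ((t + 2 : ℕ) : ZMod n) := by
    push_cast
    ring
  constructor
  · rintro e ⟨t, ht, rfl⟩
    rw [hcast]
    exact ⟨_, _, rfl, (two_le_cyclicDist_iff a (by omega) (by omega)).2 (by omega)⟩
  · intro T hT
    obtain ⟨t, ht, h⟩ := hT.exists_earCover hn a (n - 1) 0 (n - 1) (by omega) (by omega) (by omega)
      (Or.inr rfl)
    exact ⟨_, ⟨t, by omega, by rw [hcast]⟩, h⟩

end ConvexBlockers
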